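/- For the octonionic Szegő kernel S^r(x,a) = (r - x̄a)/|r - x̄a|⁸, with |a| < r ≤ 1, the Cauchy integral formula yields f(a) = r⁷ (f_r, S^r(·,a))_{S⁷} for any f left 𝕆-analytic on a neighborhood of the closed ball of radius r, where f_r(η) = f(rη) and (f,g)_{S⁷} = (1/ω₈)∫_{S⁷}(conj(g(η))η̄)(η f(η))dS. -/

import Mathlib

noncomputable section
open MeasureTheory Metric
open scoped Quaternion

/-- The octonions, via the Cayley–Dickson construction on the quaternions,
carrying the Euclidean (`L²`) norm. -/
abbrev Octonion : Type := WithLp 2 (ℍ[ℝ] × ℍ[ℝ])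

namespace Octonion

def mk (a b : ℍ[ℝ]) : Octonion := (WithLp.equiv 2 (ℍ[ℝ] × ℍ[ℝ])).symm (a, b)
def p1 (x : Octonion) : ℍ[ℝ] := (WithLp.equiv 2 (ℍ[ℝ] × ℍ[ℝ]) x).1
def p2 (x : Octonion) : ℍ[ℝ] := (WithLp.equiv 2 (ℍ[ℝ] × ℍ[ℝ]) x).2

instance : One Octonion := ⟨mk 1 0⟩
/-- Cayley–Dickson multiplication: `(a,b)(c,d) = (ac - d̄b, da + bc̄)`. -/
instance : Mul Octonion :=
  ⟨fun x y => mk (p1 x * p1 y - star (p2 y) * p2 x) (p2 y * p1 x + p2 x * star (p1 y))⟩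

/-- Octonionic conjugation. -/
def conj (x : Octonion) : Octonion := mk (star (p1 x)) (-(p2 x))

/-- The standard basis `e₀ = 1, e₁, …, e₇` of the octonions. -/
def e : Fin 8 → Octonion
  | 0 => mk 1 0
  | 1 => mk ⟨0,1,0,0⟩ 0
  | 2 => mk ⟨0,0,1,0⟩ 0
  | 3 => mk ⟨0,0,0,1⟩ 0
  | 4 => mk 0 1
  | 5 => mk 0 ⟨0,1,0,0⟩
  | 6 => mk 0 ⟨0,0,1,0⟩
  | 7 => mk 0 ⟨0,0,0,1⟩

/-- The real coordinates of an octonion w.r.t. the basis `e`. -/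
def coord (i : Fin 8) (x : Octonion) : ℝ :=
  match i with
  | 0 => (p1 x).re | 1 => (p1 x).imI | 2 => (p1 x).imJ | 3 => (p1 x).imK
  | 4 => (p2 x).re | 5 => (p2 x).imI | 6 => (p2 x).imJ | 7 => (p2 x).imK

/-- Partial derivative in the direction `e i`. -/
def pd (i : Fin 8) (f : Octonion → Octonion) (x : Octonion) : Octonion :=
  fderiv ℝ f x (e i)

/-- The generalized Cauchy–Riemann operator `Df = ∑ eᵢ ∂f/∂xᵢ`. -/
def D (f : Octonion → Octonion) (x : Octonion) : Octonion := ∑ i, e i * pd i f x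

/-- The right-acting Cauchy–Riemann operator `fD = ∑ (∂f/∂xᵢ) eᵢ`. -/
def Dright (f : Octonion → Octonion) (x : Octonion) : Octonion := ∑ i, pd i f x * e i

/-- The conjugate Cauchy–Riemann operator `D̄f = ∑ ēᵢ ∂f/∂xᵢ`. -/
def Dbar (f : Octonion → Octonion) (x : Octonion) : Octonion := ∑ i, conj (e i) * pd i f x

/-- The Laplacian `Δf = ∑ ∂²f/∂xᵢ²`. -/
def lap (f : Octonion → Octonion) (x : Octonion) : Octonion :=
  ∑ i, fderiv ℝ (fun y => fderiv ℝ f y (e i)) x (e i)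

instance : MeasurableSpace Octonion := borel _
instance : BorelSpace Octonion := ⟨rfl⟩
instance : MeasureSpace Octonion := ⟨Measure.addHaar⟩

/-- The surface measure on the unit sphere `S⁷`. -/
def sphereMeasure : Measure (sphere (0 : Octonion) 1) := (volume : Measure Octonion).toSphere

/-- `ω₈`, the surface area of the unit sphere in `ℝ⁸`. -/
def ω : ℝ := (sphereMeasure Set.univ).toReal

end Octonion

namespace Octonion

theorem p1_add (x y : Octonion) : p1 (x + y) = p1 x + p1 y := rfl
theorem p2_add (x y : Octonion) : p2 (x + y) = p2 x + p2 y := rfl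
theorem p1_sub (x y : Octonion) : p1 (x - y) = p1 x - p1 y := rfl
theorem p2_sub (x y : Octonion) : p2 (x - y) = p2 x - p2 y := rfl
theorem p1_smul (c : ℝ) (y : Octonion) : p1 (c • y) = c • p1 y := rfl
theorem p2_smul (c : ℝ) (y : Octonion) : p2 (c • y) = c • p2 y := rfl
theorem p1_mk (a b : ℍ[ℝ]) : p1 (mk a b) = a := rfl
theorem p2_mk (a b : ℍ[ℝ]) : p2 (mk a b) = b := rfl
theorem p1_one : p1 1 = 1 := rfl
theorem p2_one : p2 1 = 0 := rfl
theorem p1_mul (x y : Octonion) : p1 (x * y) = p1 x * p1 y - star (p2 y) * p2 x := rfl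
theorem p2_mul (x y : Octonion) : p2 (x * y) = p2 y * p1 x + p2 x * star (p1 y) := rfl
theorem p1_conj (x : Octonion) : p1 (conj x) = star (p1 x) := rfl
theorem p2_conj (x : Octonion) : p2 (conj x) = -(p2 x) := rfl

theorem ext' {x y : Octonion} (h1 : p1 x = p1 y) (h2 : p2 x = p2 y) : x = y := by
  apply (WithLp.equiv 2 (ℍ[ℝ] × ℍ[ℝ])).injective
  exact Prod.ext h1 h2

theorem norm_sq' (x : Octonion) : ‖x‖ ^ 2 =
    (p1 x).re ^ 2 + (p1 x).imI ^ 2 + (p1 x).imJ ^ 2 + (p1 x).imK ^ 2 +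
    ((p2 x).re ^ 2 + (p2 x).imI ^ 2 + (p2 x).imJ ^ 2 + (p2 x).imK ^ 2) := by
  rw [WithLp.prod_norm_sq_eq_of_L2]
  rw [← Quaternion.normSq_def', ← Quaternion.normSq_def', Quaternion.normSq_eq_norm_mul_self,
    Quaternion.normSq_eq_norm_mul_self, ← sq, ← sq]
  rfl

/-- Multiplication as a continuous bilinear map. -/
def mulL : Octonion →L[ℝ] Octonion →L[ℝ] Octonion :=
  (LinearMap.mk₂ ℝ (fun x y : Octonion => x * y)
    (by intro x y z; apply ext' <;> ext <;> simp [p1_add, p2_add, p1_mul, p2_mul] <;> ring)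
    (by intro x y z; apply ext' <;> ext <;> simp [p1_smul, p2_smul, p1_mul, p2_mul] <;> ring)
    (by intro x y z; apply ext' <;> ext <;> simp [p1_add, p2_add, p1_mul, p2_mul] <;> ring)
    (by intro x y z; apply ext' <;> ext <;> simp [p1_smul, p2_smul, p1_mul, p2_mul] <;> ring)
    ).toContinuousBilinearMap

theorem mulL_apply (x y : Octonion) : mulL x y = x * y := rfl

/-- Conjugation as a continuous linear map. -/
def conjL : Octonion →L[ℝ] Octonion :=
  LinearMap.toContinuousLinearMap
    { toFun := conj
      map_add' := by
        intro x y; apply ext' <;> ext <;> simp [p1_add, p2_add, p1_conj, p2_conj] <;> ring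
      map_smul' := by
        intro x y; apply ext' <;> ext <;> simp [p1_smul, p2_smul, p1_conj, p2_conj] }

theorem conjL_apply (x : Octonion) : conjL x = conj x := rfl

theorem conj_mul_mul (y c : Octonion) : conj y * (y * c) = ‖y‖ ^ 2 • c := by
  rw [norm_sq']
  apply ext' <;> ext <;> simp [p1_smul, p2_smul, p1_mul, p2_mul, p1_conj, p2_conj] <;> ring

theorem p1_e0 : p1 (e 0) = 1 := rfl
theorem p1_e1 : p1 (e 1) = ⟨0,1,0,0⟩ := rfl
theorem p1_e2 : p1 (e 2) = ⟨0,0,1,0⟩ := rfl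
theorem p1_e3 : p1 (e 3) = ⟨0,0,0,1⟩ := rfl
theorem p1_e4 : p1 (e 4) = 0 := rfl
theorem p1_e5 : p1 (e 5) = 0 := rfl
theorem p1_e6 : p1 (e 6) = 0 := rfl
theorem p1_e7 : p1 (e 7) = 0 := rfl
theorem p2_e0 : p2 (e 0) = 0 := rfl
theorem p2_e1 : p2 (e 1) = 0 := rfl
theorem p2_e2 : p2 (e 2) = 0 := rfl
theorem p2_e3 : p2 (e 3) = 0 := rfl
theorem p2_e4 : p2 (e 4) = 1 := rfl
theorem p2_e5 : p2 (e 5) = ⟨0,1,0,0⟩ := rfl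
theorem p2_e6 : p2 (e 6) = ⟨0,0,1,0⟩ := rfl
theorem p2_e7 : p2 (e 7) = ⟨0,0,0,1⟩ := rfl

theorem norm_e (i : Fin 8) : ‖e i‖ ^ 2 = 1 := by
  rw [norm_sq']
  fin_cases i <;> simp [p1_e0, p1_e1, p1_e2, p1_e3, p1_e4, p1_e5, p1_e6, p1_e7, p2_e0, p2_e1, p2_e2, p2_e3, p2_e4, p2_e5, p2_e6, p2_e7]

theorem sum_coord (x : Octonion) : ∑ i, coord i x • e i = x := by
  rw [Fin.sum_univ_eight]
  apply ext' <;> ext <;> simp only [coord, p1_add, p2_add, p1_smul, p2_smul, Quaternion.re_add, Quaternion.re_smul, Quaternion.imI_add, Quaternion.imI_smul, Quaternion.imJ_add, Quaternion.imJ_smul, Quaternion.imK_add, Quaternion.imK_smul] <;>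
      simp [coord, p1_e0, p1_e1, p1_e2, p1_e3, p1_e4, p1_e5, p1_e6, p1_e7, p2_e0, p2_e1, p2_e2, p2_e3, p2_e4, p2_e5, p2_e6, p2_e7, p1_add, p2_add, p1_smul, p2_smul]

theorem coord_sum (v : Fin 8 → ℝ) (i : Fin 8) : coord i (∑ j, v j • e j) = v i := by
  rw [Fin.sum_univ_eight]
  fin_cases i <;> simp only [coord, p1_add, p2_add, p1_smul, p2_smul, Quaternion.re_add, Quaternion.re_smul, Quaternion.imI_add, Quaternion.imI_smul, Quaternion.imJ_add, Quaternion.imJ_smul, Quaternion.imK_add, Quaternion.imK_smul] <;>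
      simp [coord, p1_e0, p1_e1, p1_e2, p1_e3, p1_e4, p1_e5, p1_e6, p1_e7, p2_e0, p2_e1, p2_e2, p2_e3, p2_e4, p2_e5, p2_e6, p2_e7, p1_add, p2_add, p1_smul, p2_smul]

theorem inner_e (x : Octonion) (i : Fin 8) : inner ℝ x (e i) = coord i x := by
  have h : inner ℝ x (e i) = (‖x + e i‖ ^ 2 - ‖x‖ ^ 2 - ‖e i‖ ^ 2) / 2 := by
    rw [norm_add_sq_real]; ring
  rw [h, norm_sq', norm_sq', norm_sq']
  fin_cases i <;> simp only [coord, p1_add, p2_add, p1_smul, p2_smul, Quaternion.re_add, Quaternion.re_smul, Quaternion.imI_add, Quaternion.imI_smul, Quaternion.imJ_add, Quaternion.imJ_smul, Quaternion.imK_add, Quaternion.imK_smul] <;>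
      simp [coord, p1_e0, p1_e1, p1_e2, p1_e3, p1_e4, p1_e5, p1_e6, p1_e7, p2_e0, p2_e1, p2_e2, p2_e3, p2_e4, p2_e5, p2_e6, p2_e7, p1_add, p2_add] <;> ring

theorem kernel_eq (r : ℝ) (η a : Octonion) (hη : ‖η‖ = 1) :
    conj (r • (1 : Octonion) - conj η * a) * conj η = conj (r • η - a) := by
  have h : ‖η‖ ^ 2 = 1 := by rw [hη]; norm_num
  have h2 : conj (r • (1 : Octonion) - conj η * a) * conj η =
    r • conj η - ‖η‖ ^ 2 • conj a := by
    rw [norm_sq']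
    apply ext' <;> ext <;> simp [p1_smul, p2_smul, p1_mul, p2_mul, p1_conj, p2_conj, p1_sub, p2_sub, p1_one, p2_one] <;> ring
  rw [h2, h, one_smul]
  simp only [← conjL_apply, map_sub, map_smul]

theorem norm_kernel (r : ℝ) (η a : Octonion) (hη : ‖η‖ = 1) :
    ‖r • (1 : Octonion) - conj η * a‖ = ‖r • η - a‖ := by
  have h : ‖η‖ ^ 2 = 1 := by rw [hη]; norm_num
  have h2 : ‖r • (1 : Octonion) - conj η * a‖ ^ 2 - (1 - ‖η‖ ^ 2) * r ^ 2 =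
      ‖r • η - a‖ ^ 2 - (1 - ‖η‖ ^ 2) * ‖a‖ ^ 2 := by
    rw [norm_sq', norm_sq', norm_sq', norm_sq']
    simp [p1_smul, p2_smul, p1_mul, p2_mul, p1_conj, p2_conj, p1_sub, p2_sub, p1_one, p2_one]
    ring
  rw [h] at h2
  have h3 : ‖r • (1 : Octonion) - conj η * a‖ ^ 2 = ‖r • η - a‖ ^ 2 := by linarith
  exact (sq_eq_sq₀ (norm_nonneg _) (norm_nonneg _)).1 h3

/-- Coordinates give a continuous linear equivalence with `ℝ⁸`. -/
def L : (Fin 8 → ℝ) ≃L[ℝ] Octonion :=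
  LinearEquiv.toContinuousLinearEquiv
    { toFun := fun v => ∑ i, v i • e i
      map_add' := by intro x y; simp [add_smul, Finset.sum_add_distrib]
      map_smul' := by intro x y; simp [mul_smul, Finset.smul_sum]
      invFun := fun x i => coord i x
      left_inv := fun v => funext fun i => coord_sum v i
      right_inv := fun x => sum_coord x }

theorem L_single (i : Fin 8) : L (Pi.single i 1) = e i := by
  change ∑ j, (Pi.single i (1:ℝ) : Fin 8 → ℝ) j • e j = e i
  simp [Pi.single_apply]

end Octonion

namespace Octonion
open Set

theorem polar_integral {E : Type*} [NormedAddCommGroup E] [NormedSpace ℝ E] [MeasurableSpace E]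
    [FiniteDimensional ℝ E] [BorelSpace E] [Nontrivial E] (μ : Measure E) [μ.IsAddHaarMeasure]
    {G : Type*} [NormedAddCommGroup G] [NormedSpace ℝ G] (F : E → G) (hF : Integrable F μ) :
    ∫ x, F x ∂μ = ∫ ρ in Ioi (0:ℝ), ρ ^ (Module.finrank ℝ E - 1) •
      ∫ η : sphere (0:E) 1, F (ρ • (η : E)) ∂μ.toSphere := by
  set g : sphere (0:E) 1 × Ioi (0:ℝ) → G := fun p => F (p.2.1 • p.1.1) with hg
  have hgc : ∀ x : ({0}ᶜ : Set E), g (homeomorphUnitSphereProd E x) = F x.1 := by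
    intro x
    have := congrArg Subtype.val ((homeomorphUnitSphereProd E).symm_apply_apply x)
    simp only [homeomorphUnitSphereProd_symm_apply_coe] at this
    simp only [hg]
    rw [this]
  have hint : Integrable g (μ.toSphere.prod (Measure.volumeIoiPow (Module.finrank ℝ E - 1))) := by
    rw [← μ.measurePreserving_homeomorphUnitSphereProd.integrable_comp_emb
      (Homeomorph.measurableEmbedding _)]
    have : g ∘ (homeomorphUnitSphereProd E) = F ∘ Subtype.val := funext hgc
    rw [this]
    rw [← integrableOn_iff_comap_subtypeVal (by measurability)]
    exact hF.integrableOn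
  calc ∫ x, F x ∂μ = ∫ x : ({(0)}ᶜ : Set E), F x.1 ∂(μ.comap (↑)) := by
        rw [integral_subtype_comap (measurableSet_singleton _).compl fun x ↦ F x,
          MeasureTheory.restrict_compl_singleton]
    _ = ∫ x, g x ∂μ.toSphere.prod (.volumeIoiPow (Module.finrank ℝ E - 1)) := by
        rw [← μ.measurePreserving_homeomorphUnitSphereProd.integral_comp
          (Homeomorph.measurableEmbedding _)]
        simp only [hgc]
    _ = ∫ ρ : Ioi (0:ℝ), ∫ η, g (η, ρ) ∂μ.toSphere ∂(.volumeIoiPow (Module.finrank ℝ E - 1)) :=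
        integral_prod_symm _ hint
    _ = _ := by
        simp only [Measure.volumeIoiPow, ENNReal.ofReal]
        rw [integral_withDensity_eq_integral_smul,
          integral_subtype_comap measurableSet_Ioi
            fun a ↦ Real.toNNReal (a ^ (Module.finrank ℝ E - 1)) •
              ∫ η : sphere (0:E) 1, F (a • (η : E)) ∂μ.toSphere,
          setIntegral_congr_fun measurableSet_Ioi fun x hx ↦ ?_]
        · simp only [NNReal.smul_def]
          rw [Real.coe_toNNReal _ (pow_nonneg hx.out.le _)]
        · exact (measurable_subtype_coe.pow_const _).real_toNNReal

theorem div_zero_pi {G : Type*} [NormedAddCommGroup G] [NormedSpace ℝ G] {n : ℕ}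
    (V : Fin (n+1) → (Fin (n+1) → ℝ) → G)
    (V' : Fin (n+1) → (Fin (n+1) → ℝ) → (Fin (n+1) → ℝ) →L[ℝ] G)
    (hV : ∀ i x, HasFDerivAt (V i) (V' i x) x) (R : ℝ) (hR : 0 < R)
    (hs : ∀ i x, R ≤ ‖x‖ → V i x = 0)
    (hi : Integrable (fun x => ∑ i, V' i x (Pi.single i 1))) :
    ∫ x, ∑ i, V' i x (Pi.single i 1) = 0 := by
  have key := integral_divergence_of_hasFDerivAt_off_countable' (fun _ => -(R+1)) (fun _ => R+1)
    (fun _ => by simp only []; linarith) V V' ∅ countable_empty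
    (fun i => fun x _ => (hV i x).continuousAt.continuousWithinAt)
    (fun x _ i => hV i x) hi.integrableOn
  have h0 : ∀ x : Fin (n+1) → ℝ, x ∉ Icc (fun _ => -(R+1) : Fin (n+1) → ℝ) (fun _ => R+1) →
      ∑ i, V' i x (Pi.single i 1) = 0 := by
    intro x hx
    have hRx : R < ‖x‖ := by
      by_contra hcon
      apply hx
      push Not at hcon
      have : ∀ i, |x i| ≤ R := fun i => (norm_le_pi_norm x i).trans hcon
      exact ⟨fun i => by have := abs_le.1 (this i); simp only []; linarith,
        fun i => by have := abs_le.1 (this i); simp only []; linarith⟩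
    apply Finset.sum_eq_zero
    intro i _
    have hz : V i =ᶠ[nhds x] fun _ => 0 := by
      have : ∀ᶠ y in nhds x, R < ‖y‖ := continuous_norm.continuousAt.eventually (lt_mem_nhds hRx)
      filter_upwards [this] with y hy using hs i y hy.le
    have h1 := (hV i x).congr_of_eventuallyEq hz.symm
    rw [h1.unique (hasFDerivAt_const (0:G) x)]
    rfl
  rw [setIntegral_eq_integral_of_forall_compl_eq_zero h0] at key
  rw [key]
  apply Finset.sum_eq_zero
  intro i _
  have hf : ∀ (c : ℝ) (y : Fin n → ℝ), R ≤ |c| → V i (i.insertNth c y) = 0 := by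
    intro c y hc
    apply hs
    refine hc.trans ?_
    have := norm_le_pi_norm (i.insertNth c y : Fin (n+1) → ℝ) i
    simpa using this
  have h1 : ∀ y : Fin n → ℝ, V i (i.insertNth (R+1) y) = 0 := fun y =>
    hf _ _ (by rw [abs_of_pos] <;> linarith)
  have h2 : ∀ y : Fin n → ℝ, V i (i.insertNth (-(R+1)) y) = 0 := fun y =>
    hf _ _ (by rw [abs_neg, abs_of_pos] <;> linarith)
  simp only [h1, h2, integral_zero, sub_zero]

end Octonion

namespace Octonion
open Set

instance haar_volume : (volume : Measure Octonion).IsAddHaarMeasure :=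
  inferInstanceAs (Measure.addHaar (G := Octonion)).IsAddHaarMeasure

theorem finrank_eq : Module.finrank ℝ Octonion = 8 := by
  rw [← L.toLinearEquiv.finrank_eq]; simp

instance nontriv : Nontrivial Octonion :=
  Module.nontrivial_of_finrank_pos (R := ℝ) (by rw [finrank_eq]; norm_num)

theorem div_zero' (V : Fin 8 → Octonion → Octonion)
    (V' : Fin 8 → Octonion → Octonion →L[ℝ] Octonion)
    (hV : ∀ i x, HasFDerivAt (V i) (V' i x) x) (R : ℝ) (hR : 0 < R)
    (hs : ∀ i x, R ≤ ‖x‖ → V i x = 0)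
    (hi : Integrable (fun x => ∑ i, V' i x (e i))) :
    ∫ x, ∑ i, V' i x (e i) = 0 := by
  set μ : Measure Octonion := Measure.map L volume with hμ
  have : μ.IsAddHaarMeasure := L.isAddHaarMeasure_map volume
  have h1 : μ = Measure.addHaarScalarFactor μ volume • (volume : Measure Octonion) :=
    Measure.isAddLeftInvariant_eq_smul _ _
  have h2 : (volume : Measure Octonion) = Measure.addHaarScalarFactor volume μ • μ :=
    Measure.isAddLeftInvariant_eq_smul _ _
  have hLm : MeasurableEmbedding L := L.toHomeomorph.measurableEmbedding
  have hiμ : Integrable (fun x => ∑ i, V' i x (e i)) μ := by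
    rw [h1]; exact hi.smul_measure_nnreal
  have key := div_zero_pi (n := 7) (fun i v => V i (L v))
    (fun i v => (V' i (L v)).comp (L : (Fin 8 → ℝ) →L[ℝ] Octonion))
    (fun i v => (hV i (L v)).comp v L.hasFDerivAt)
    ((‖(L.symm : Octonion →L[ℝ] (Fin 8 → ℝ))‖ + 1) * R) (by positivity)
    (by
      intro i v hv
      apply hs
      have := (L.symm : Octonion →L[ℝ] (Fin 8 → ℝ)).le_opNorm (L v)
      simp only [ContinuousLinearEquiv.coe_coe, ContinuousLinearEquiv.symm_apply_apply] at this
      have h3 : (‖(L.symm : Octonion →L[ℝ] (Fin 8 → ℝ))‖ + 1) * R ≤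
        (‖(L.symm : Octonion →L[ℝ] (Fin 8 → ℝ))‖ + 1) * ‖L v‖ := by
        nlinarith [norm_nonneg (L v)]
      exact le_of_mul_le_mul_left h3 (by positivity))
    (by
      rw [hμ, hLm.integrable_map_iff] at hiμ
      refine hiμ.congr (Filter.Eventually.of_forall fun v => ?_)
      simp [L_single])
  have h4 : ∫ x, ∑ i, V' i x (e i) ∂μ = 0 := by
    rw [hμ, hLm.integral_map, ← key]
    simp [L_single]
  rw [h2, integral_smul_nnreal_measure, h4, smul_zero]

theorem hasFDerivAt_norm' (x : Octonion) (hx : x ≠ 0) :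
    HasFDerivAt (fun y : Octonion => ‖y‖) (‖x‖⁻¹ • innerSL ℝ x) x := by
  have h1 := (hasStrictFDerivAt_norm_sq x).hasFDerivAt
  have h2 := h1.sqrt (by simpa using hx)
  simp only [Real.sqrt_sq (norm_nonneg _)] at h2
  have hn : ‖x‖ ≠ 0 := by simpa using hx
  refine h2.congr_fderiv ?_
  ext v
  simp
  field_simp

/-- radial cutoff -/
def cut (φ : ℝ → ℝ) (x : Octonion) : ℝ := 1 - ∫ u in (0:ℝ)..‖x‖, φ u

theorem cut_inner {φ : ℝ → ℝ} {s t : ℝ} (hφ : ∀ u, u ≤ s ∨ t ≤ u → φ u = 0)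
    {x : Octonion} (hx : ‖x‖ ≤ s) : cut φ x = 1 := by
  unfold cut
  rw [intervalIntegral.integral_congr (g := fun _ => 0)]
  · simp
  · intro u hu
    rw [uIcc_of_le (norm_nonneg x)] at hu
    exact hφ u (Or.inl (hu.2.trans hx))

theorem cut_outer {φ : ℝ → ℝ} {s t : ℝ} (hs : 0 < s) (hφ : ∀ u, u ≤ s ∨ t ≤ u → φ u = 0)
    (h1 : ∫ u, φ u = 1) {x : Octonion} (hx : t ≤ ‖x‖) : cut φ x = 0 := by
  unfold cut
  rw [intervalIntegral.integral_eq_integral_of_support_subset, h1, sub_self]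
  intro u hu
  by_contra hcon
  apply hu
  apply hφ
  rw [mem_Ioc, not_and_or] at hcon
  rcases hcon with h | h
  · left; linarith
  · right; linarith

theorem hasFDerivAt_cut {φ : ℝ → ℝ} {s t : ℝ} (hc : Continuous φ) (hs : 0 < s)
    (hφ : ∀ u, u ≤ s ∨ t ≤ u → φ u = 0) (x : Octonion) :
    HasFDerivAt (cut φ) (-(φ ‖x‖ * ‖x‖⁻¹) • innerSL ℝ x) x := by
  by_cases hx : x = 0
  · subst hx
    have : cut φ =ᶠ[nhds 0] fun _ => 1 := by
      filter_upwards [ball_mem_nhds (0 : Octonion) hs] with y hy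
      exact cut_inner hφ (by exact (mem_ball_zero_iff.1 hy).le)
    have h2 := (hasFDerivAt_const (𝕜 := ℝ) (1:ℝ) (0 : Octonion)).congr_of_eventuallyEq this
    refine h2.congr_fderiv ?_
    simp
  · have h1 : HasDerivAt (fun u => ∫ v in (0:ℝ)..u, φ v) (φ ‖x‖) ‖x‖ :=
      intervalIntegral.integral_hasDerivAt_right (hc.intervalIntegrable _ _)
        (hc.stronglyMeasurableAtFilter _ _) hc.continuousAt
    have h2 := (h1.comp_hasFDerivAt x (hasFDerivAt_norm' x hx)).const_sub 1
    refine h2.congr_fderiv ?_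
    rw [smul_smul, neg_smul]

/-- The Cauchy kernel. -/
def Ek (y : Octonion) : Octonion := (‖y‖ ^ 8)⁻¹ • conj y

theorem hasFDerivAt_Ek (y : Octonion) (hy : y ≠ 0) :
    ∃ E' : Octonion →L[ℝ] Octonion, HasFDerivAt Ek E' y ∧
      ∀ v, E' v = (‖y‖ ^ 8)⁻¹ • conj v - (8 * (‖y‖ ^ 10)⁻¹ * inner ℝ y v) • conj y := by
  have hn : ‖y‖ ≠ 0 := by simpa using hy
  have h1 := (hasStrictFDerivAt_norm_sq y).hasFDerivAt
  have hd : HasDerivAt (fun u : ℝ => (u ^ 4)⁻¹) (-(4 * (‖y‖^2)^3) / ((‖y‖^2)^4)^2) (‖y‖^2) := by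
    have := (hasDerivAt_pow 4 (‖y‖^2)).inv (by positivity)
    norm_num at this
    exact this
  have h2 := hd.comp_hasFDerivAt y h1
  have h3 := h2.smul conjL.hasFDerivAt
  refine ⟨_, h3.congr_of_eventuallyEq (Filter.Eventually.of_forall fun z => ?_), ?_⟩
  · change (‖z‖ ^ 8)⁻¹ • conj z = ((‖z‖ ^ 2) ^ 4)⁻¹ • conj z
    rw [← pow_mul]
  · intro v
    simp [conjL_apply]
    rw [sub_eq_add_neg, ← neg_smul]
    congr 2
    · rw [← pow_mul]
    · field_simp
      ring

theorem continuousAt_Ek (y : Octonion) (hy : y ≠ 0) : ContinuousAt Ek y := by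
  obtain ⟨E', h, _⟩ := hasFDerivAt_Ek y hy
  exact h.continuousAt

theorem mul_sum (x : Octonion) (g : Fin 8 → Octonion) : x * ∑ i, g i = ∑ i, x * g i := by
  simp only [← mulL_apply, map_sum]
theorem smul_mul' (c : ℝ) (x y : Octonion) : (c • x) * y = c • (x * y) := by
  simp only [← mulL_apply, map_smul, smul_apply]
theorem mul_smul' (c : ℝ) (x y : Octonion) : x * (c • y) = c • (x * y) := by
  simp only [← mulL_apply, map_smul]
theorem sub_mul' (x y z : Octonion) : (x - y) * z = x * z - y * z := by
  simp only [← mulL_apply, map_sub, sub_apply]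
theorem add_mul' (x y z : Octonion) : (x + y) * z = x * z + y * z := by
  simp only [← mulL_apply, map_add, add_apply]

theorem sum_inner_e (x c : Octonion) : ∑ i, (inner ℝ x (e i) : ℝ) • (e i * c) = x * c := by
  conv_rhs => rw [← sum_coord x]
  simp only [← mulL_apply, map_sum, sum_apply, map_smul,
    smul_apply, inner_e]

theorem Ek_left (y c : Octonion) (E' : Octonion →L[ℝ] Octonion) (hy : y ≠ 0)
    (h : ∀ v, E' v = (‖y‖ ^ 8)⁻¹ • conj v - (8 * (‖y‖ ^ 10)⁻¹ * inner ℝ y v) • conj y) :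
    ∑ i, E' (e i) * (e i * c) = 0 := by
  have hn : ‖y‖ ≠ 0 := by simpa using hy
  have h1 : ∀ i, E' (e i) * (e i * c) = (‖y‖ ^ 8)⁻¹ • c -
      (8 * (‖y‖ ^ 10)⁻¹) • (conj y * ((inner ℝ y (e i) : ℝ) • (e i * c))) := by
    intro i
    rw [h, sub_mul', smul_mul', conj_mul_mul, norm_e, one_smul, smul_mul', mul_smul', smul_smul]
  simp only [h1, Finset.sum_sub_distrib, ← Finset.smul_sum, ← mul_sum]
  rw [sum_inner_e, conj_mul_mul]
  simp only [Finset.sum_const, Finset.card_univ, Fintype.card_fin, smul_smul,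
    ← Nat.cast_smul_eq_nsmul ℝ]
  rw [← sub_smul]
  convert zero_smul ℝ c
  field_simp
  norm_num

end Octonion

namespace Octonion
open Set

instance finite_sphereMeasure : IsFiniteMeasure sphereMeasure :=
  inferInstanceAs (IsFiniteMeasure (volume : Measure Octonion).toSphere)

theorem continuousOn_sphere_integral {s t : ℝ} (hs : 0 ≤ s)
    (K : Octonion → Octonion) (hK : ContinuousOn K {x | s ≤ ‖x‖ ∧ ‖x‖ ≤ t}) :
    ContinuousOn (fun ρ : ℝ => ∫ η : sphere (0 : Octonion) 1, K (ρ • (η : Octonion))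
      ∂sphereMeasure) (Icc s t) := by
  rw [continuousOn_iff_continuous_domRestrict]
  have h1 : Continuous (Function.uncurry fun (ρ : Icc s t) (η : sphere (0 : Octonion) 1) =>
      K ((ρ : ℝ) • (η : Octonion))) := by
    refine hK.comp_continuous (f := fun p : Icc s t × sphere (0 : Octonion) 1 =>
      (p.1 : ℝ) • (p.2 : Octonion)) (by fun_prop) ?_
    rintro ⟨ρ, η⟩
    have : ‖(ρ : ℝ) • (η : Octonion)‖ = ρ := by
      rw [norm_smul, norm_eq_of_mem_sphere η, mul_one, Real.norm_eq_abs,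
        abs_of_nonneg (hs.trans ρ.2.1)]
    simp only [mem_ofPred_eq]
    rw [this]
    exact ρ.2
  have h2 := continuous_parametric_integral_of_continuous (μ := sphereMeasure) h1
    (isCompact_univ (X := sphere (0 : Octonion) 1))
  simpa [Set.domRestrict_def] using h2

theorem integrable_of_shell {X : Type*} [TopologicalSpace X] [T2Space X] [MeasurableSpace X]
    [OpensMeasurableSpace X]
    {μ : Measure X} [IsFiniteMeasureOnCompacts μ] {G : Type*} [NormedAddCommGroup G]
    {A : Set X} (hA : IsCompact A) {F : X → G} (hF : ContinuousOn F A) (h0 : ∀ x, x ∉ A → F x = 0) :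
    Integrable F μ := by
  rw [← integrableOn_iff_integrable_of_support_subset (s := A)]
  · exact hF.integrableOn_compact hA
  · intro x hx
    by_contra hcon
    exact hx (h0 x hcon)

theorem isCompact_shell (s t : ℝ) : IsCompact {x : Octonion | s ≤ ‖x‖ ∧ ‖x‖ ≤ t} := by
  refine (isCompact_closedBall (0 : Octonion) t).of_isClosed_subset ?_ ?_
  · exact (isClosed_le continuous_const continuous_norm).inter
      (isClosed_le continuous_norm continuous_const)
  · intro x hx
    simpa using hx.2

theorem integrable_shell {φ : ℝ → ℝ} {s t : ℝ} (hc : Continuous φ)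
    (hφ : ∀ u, u ≤ s ∨ t ≤ u → φ u = 0)
    (K : Octonion → Octonion) (hK : ContinuousOn K {x | s ≤ ‖x‖ ∧ ‖x‖ ≤ t}) :
    Integrable (fun x => φ ‖x‖ • K x) := by
  refine integrable_of_shell (isCompact_shell s t) ?_ ?_
  · exact (hc.comp continuous_norm).continuousOn.smul hK
  · intro x hx
    simp only [mem_ofPred_eq, not_and_or, not_le] at hx
    rw [hφ, zero_smul]
    exact hx.imp le_of_lt le_of_lt

theorem polar_shell {φ : ℝ → ℝ} {s t : ℝ} (hc : Continuous φ) (hs : 0 < s)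
    (hφ : ∀ u, u ≤ s ∨ t ≤ u → φ u = 0)
    (K : Octonion → Octonion) (hK : ContinuousOn K {x | s ≤ ‖x‖ ∧ ‖x‖ ≤ t}) :
    ∫ x, φ ‖x‖ • K x = ∫ ρ : ℝ, φ ρ • (ρ ^ 7 •
      ∫ η : sphere (0 : Octonion) 1, K (ρ • (η : Octonion)) ∂sphereMeasure) := by
  rw [polar_integral volume _ (integrable_shell hc hφ K hK), finrank_eq]
  rw [← setIntegral_eq_integral_of_forall_compl_eq_zero (s := Ioi (0:ℝ)) (f := fun ρ : ℝ =>
    φ ρ • (ρ ^ 7 • ∫ η : sphere (0 : Octonion) 1, K (ρ • (η : Octonion)) ∂sphereMeasure))]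
  · refine setIntegral_congr_fun measurableSet_Ioi fun ρ hρ => ?_
    have hρ' : (0:ℝ) < ρ := hρ
    have : ∀ η : sphere (0 : Octonion) 1, ‖ρ • (η : Octonion)‖ = ρ := by
      intro η
      rw [norm_smul, norm_eq_of_mem_sphere η, mul_one, Real.norm_eq_abs, abs_of_pos hρ']
    simp only [this]
    rw [integral_smul, smul_comm]
    rfl
  · intro ρ hρ
    rw [hφ, zero_smul]
    left
    have : ρ ≤ 0 := by simpa using hρ
    linarith

theorem dirac {s t ρ₀ : ℝ} (hs : s < ρ₀) (ht : ρ₀ < t) (N : ℝ → Octonion)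
    (hN : ContinuousOn N (Icc s t)) (c : Octonion)
    (h : ∀ φ : ℝ → ℝ, Continuous φ → (∀ u, u ≤ s ∨ t ≤ u → φ u = 0) → ∫ u, φ u = 1 →
      ∫ u, φ u • N u = c) : N ρ₀ = c := by
  have hcont : ContinuousAt N ρ₀ := hN.continuousAt (Icc_mem_nhds hs ht)
  by_contra hne
  have hpos : 0 < dist (N ρ₀) c := dist_pos.2 hne
  obtain ⟨δ, hδ, hδ'⟩ := Metric.continuousAt_iff.1 hcont (dist (N ρ₀) c / 2) (by positivity)
  set d := min δ (min (ρ₀ - s) (t - ρ₀)) with hd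
  have hd0 : 0 < d := by
    simp only [hd, lt_min_iff]
    exact ⟨hδ, by linarith, by linarith⟩
  have hd1 : d ≤ δ := min_le_left _ _
  have hd2 : d ≤ ρ₀ - s := (min_le_right _ _).trans (min_le_left _ _)
  have hd3 : d ≤ t - ρ₀ := (min_le_right _ _).trans (min_le_right _ _)
  let b : ContDiffBump ρ₀ := ⟨d / 2, d, by positivity, by linarith⟩
  have hb0 : ∀ u, u ∉ ball ρ₀ d → b.normed volume u = 0 := by
    intro u hu
    have h3 := b.support_normed_eq (μ := volume)
    by_contra h4
    exact hu (by rw [← show b.rOut = d from rfl, ← h3]; exact h4)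
  have hbc : Continuous (b.normed volume) := b.continuous_normed
  have hb1 : ∫ u, b.normed volume u = 1 := b.integral_normed
  have hbs : ∀ u, u ≤ s ∨ t ≤ u → b.normed volume u = 0 := by
    intro u hu
    apply hb0
    rw [Metric.mem_ball, Real.dist_eq, abs_lt]
    rintro ⟨h5, h6⟩
    rcases hu with hu | hu <;> linarith
  have hh := h _ hbc hbs hb1
  have hbi : Integrable (b.normed volume) volume := b.integrable_normed
  have hi1 : Integrable (fun u => b.normed volume u • N u) volume := by
    refine integrable_of_shell (isCompact_Icc (a := s) (b := t)) (hbc.continuousOn.smul hN) ?_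
    intro u hu
    rw [hbs, zero_smul]
    simp only [mem_Icc, not_and_or, not_le] at hu
    exact hu.imp le_of_lt le_of_lt
  have hi2 : Integrable (fun u => b.normed volume u • N ρ₀) volume := hbi.smul_const _
  have e1 : c - N ρ₀ = ∫ u, b.normed volume u • (N u - N ρ₀) := by
    simp only [smul_sub]
    rw [integral_sub hi1 hi2, hh, integral_smul_const, hb1, one_smul]
  have e2 : ‖c - N ρ₀‖ ≤ ∫ u, b.normed volume u * (dist (N ρ₀) c / 2) := by
    rw [e1]
    refine norm_integral_le_of_norm_le (hbi.mul_const _) (Filter.Eventually.of_forall fun u => ?_)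
    rw [norm_smul, Real.norm_eq_abs, abs_of_nonneg (b.nonneg_normed u)]
    by_cases hu : u ∈ ball ρ₀ d
    · refine mul_le_mul_of_nonneg_left ?_ (b.nonneg_normed u)
      rw [← dist_eq_norm]
      exact (hδ' (lt_of_lt_of_le (Metric.mem_ball.1 hu) hd1)).le
    · simp only [hb0 u hu, zero_mul, le_refl]
  rw [integral_mul_const, hb1, one_mul, ← dist_eq_norm, dist_comm] at e2
  linarith

end Octonion

namespace Octonion
open Set

theorem continuousOn_mul {X : Type*} [TopologicalSpace X] {A : Set X} {g h : X → Octonion}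
    (hg : ContinuousOn g A) (hh : ContinuousOn h A) : ContinuousOn (fun x => g x * h x) A := by
  simp only [← mulL_apply]
  exact (mulL.continuous.comp_continuousOn hg).clm_apply hh

theorem hasFDerivAt_mul {g h : Octonion → Octonion} {g' h' : Octonion →L[ℝ] Octonion}
    {x : Octonion} (hg : HasFDerivAt g g' x) (hh : HasFDerivAt h h' x) :
    ∃ m : Octonion →L[ℝ] Octonion, HasFDerivAt (fun x => g x * h x) m x ∧
      ∀ v, m v = g' v * h x + g x * h' v := by
  have := mulL.hasFDerivAt_of_bilinear hg hh
  refine ⟨_, this, fun v => ?_⟩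
  simp [mulL_apply]
  abel

theorem contK1 {a : Octonion} {f : Octonion → Octonion} {s t : ℝ} (hs : 0 < s) (ha : ‖a‖ < s)
    (hf : ContinuousOn f (closedBall 0 t)) :
    ContinuousOn (fun x => ‖x‖⁻¹ • (Ek (x - a) * (x * f x))) {x | s ≤ ‖x‖ ∧ ‖x‖ ≤ t} := by
  refine ContinuousOn.smul (continuous_norm.continuousOn.inv₀ ?_)
    (continuousOn_mul ?_ (continuousOn_mul continuousOn_id (hf.mono ?_)))
  · intro x hx
    exact (lt_of_lt_of_le hs hx.1).ne'
  · intro x hx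
    have hne : x - a ≠ 0 := by
      intro h0
      rw [sub_eq_zero.1 h0] at hx
      exact absurd hx.1 (not_le.2 ha)
    exact ((continuousAt_Ek _ hne).comp (f := fun x => x - a)
      (by fun_prop)).continuousWithinAt
  · intro x hx
    simpa using hx.2

theorem contK2 {a : Octonion} {f : Octonion → Octonion} {s' t t' : ℝ} (hs' : 0 < s')
    (hat : ‖a‖ + t' ≤ t)
    (hf : ContinuousOn f (closedBall 0 t)) :
    ContinuousOn (fun y => ‖y‖⁻¹ • (Ek y * (y * f (a + y)))) {x | s' ≤ ‖x‖ ∧ ‖x‖ ≤ t'} := by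
  refine ContinuousOn.smul (continuous_norm.continuousOn.inv₀ ?_)
    (continuousOn_mul ?_ (continuousOn_mul continuousOn_id (hf.comp (by fun_prop) ?_)))
  · intro x hx
    exact (lt_of_lt_of_le hs' hx.1).ne'
  · intro x hx
    have hne : x ≠ 0 := norm_pos_iff.1 (lt_of_lt_of_le hs' hx.1)
    exact (continuousAt_Ek _ hne).continuousWithinAt
  · intro x hx
    have := norm_add_le a x
    have h2 := hx.2
    simp only [mem_closedBall_zero_iff]
    linarith

theorem core {a : Octonion} {f : Octonion → Octonion} {U : Set Octonion} (hU : IsOpen U)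
    (hdiff : DifferentiableOn ℝ f U) (hD : ∀ x ∈ U, D f x = 0)
    {φ ψ : ℝ → ℝ} {s t s' t' : ℝ} (hcφ : Continuous φ) (hcψ : Continuous ψ)
    (hs : 0 < s) (hs' : 0 < s') (ht : 0 < t)
    (hφ : ∀ u, u ≤ s ∨ t ≤ u → φ u = 0) (hψ : ∀ u, u ≤ s' ∨ t' ≤ u → ψ u = 0)
    (h1φ : ∫ u, φ u = 1) (h1ψ : ∫ u, ψ u = 1) (ha : ‖a‖ < s) (hat : ‖a‖ + t' ≤ t)
    (hsub : closedBall 0 t ⊆ U) :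
    ∫ x, φ ‖x‖ • (‖x‖⁻¹ • (Ek (x - a) * (x * f x))) =
      ∫ y, ψ ‖y‖ • (‖y‖⁻¹ • (Ek y * (y * f (a + y)))) := by
  have hfc : ContinuousOn f (closedBall 0 t) := hdiff.continuousOn.mono hsub
  have hi1 := integrable_shell hcφ hφ _ (contK1 hs ha hfc)
  have hi2 := (integrable_shell hcψ hψ _ (contK2 hs' hat hfc)).comp_sub_right a
  rw [← integral_sub_right_eq_self (fun y => ψ ‖y‖ • (‖y‖⁻¹ • (Ek y * (y * f (a + y))))) a]
  simp only [add_sub_cancel] at hi2 ⊢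
  symm
  rw [← sub_eq_zero, ← integral_sub hi2 hi1]
  have hi := hi2.sub hi1
  set G : Octonion → Octonion := fun x => (cut φ x - cut ψ (x - a)) • Ek (x - a) with hG
  set V : Fin 8 → Octonion → Octonion := fun i x => G x * (e i * f x) with hV
  -- vanishing
  have hGa : ∀ᶠ x in nhds a, G x = 0 := by
    have e1 : ∀ᶠ x in nhds a, ‖x‖ < s := continuous_norm.continuousAt.eventually (gt_mem_nhds ha)
    filter_upwards [e1, ball_mem_nhds a hs'] with x hx hx'
    simp only [hG]
    rw [cut_inner hφ hx.le, cut_inner hψ (mem_ball_iff_norm.1 hx').le, sub_self, zero_smul]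
  have hfar : ∀ x : Octonion, t ≤ ‖x‖ → t' ≤ ‖x - a‖ := by
    intro x hx
    have := norm_sub_norm_le x a
    linarith
  have hGt : ∀ x, t ≤ ‖x‖ → G x = 0 := by
    intro x hx
    simp only [hG]
    rw [cut_outer hs hφ h1φ hx, cut_outer hs' hψ h1ψ (hfar x hx), sub_self, zero_smul]
  have zmul : ∀ y : Octonion, (0 : Octonion) * y = 0 := by
    intro y; simp only [← mulL_apply, map_zero, zero_apply]
  have mulz : ∀ y : Octonion, y * (0 : Octonion) = 0 := by
    intro y; simp only [← mulL_apply, map_zero]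
  have hzero : ∀ x, (∀ᶠ y in nhds x, G y = 0) → ∀ i, HasFDerivAt (V i) (0 : Octonion →L[ℝ] Octonion) x := by
    intro x hx i
    refine (hasFDerivAt_const (𝕜 := ℝ) (0:Octonion) x).congr_of_eventuallyEq ?_
    filter_upwards [hx] with y hy
    simp only [hV, hy, zmul]
  have hnotU : ∀ x, x ∉ U → t < ‖x‖ := by
    intro x hx
    by_contra hcon
    exact hx (hsub (by simpa using hcon))
  -- derivative
  have hder : ∀ x, ∃ V' : Fin 8 → Octonion →L[ℝ] Octonion, (∀ i, HasFDerivAt (V i) (V' i) x) ∧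
      ∑ i, V' i (e i) = ψ ‖x - a‖ • ‖x - a‖⁻¹ • (Ek (x - a) * ((x - a) * f x)) -
        φ ‖x‖ • ‖x‖⁻¹ • (Ek (x - a) * (x * f x)) := by
    intro x
    by_cases hxU : x ∈ U
    · by_cases hxa : x = a
      · refine ⟨fun _ => 0, hzero x (hxa ▸ hGa), ?_⟩
        subst hxa
        rw [hφ ‖x‖ (Or.inl ha.le), hψ _ (Or.inl (by simpa using hs'.le))]
        simp
      · have hne : x - a ≠ 0 := sub_ne_zero.2 hxa
        obtain ⟨E', hE', hE''⟩ := hasFDerivAt_Ek (x - a) hne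
        have hsubd : HasFDerivAt (fun x : Octonion => x - a)
          (ContinuousLinearMap.id ℝ Octonion) x := (hasFDerivAt_id x).sub_const a
        have d1 := hasFDerivAt_cut hcφ hs hφ x
        have d2 := (hasFDerivAt_cut hcψ hs' hψ (x - a)).comp x hsubd
        have d3 := hE'.comp x hsubd
        have d4 := (d1.sub d2).smul d3
        have d5 := (hdiff.differentiableAt (hU.mem_nhds hxU)).hasFDerivAt
        have d6 : ∀ i, HasFDerivAt (fun x => e i * f x) ((mulL (e i)).comp (fderiv ℝ f x)) x :=
          fun i => (mulL (e i)).hasFDerivAt.comp x d5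
        choose m hm hm' using fun i => hasFDerivAt_mul d4 (d6 i)
        refine ⟨m, hm, ?_⟩
        have hDx := hD x hxU
        simp only [D, pd] at hDx
        have hL := Ek_left (x - a) (f x) E' hne hE''
        have hterm : ∀ i, m i (e i) =
            (cut φ x - cut ψ (x - a)) • (E' (e i) * (e i * f x)) +
            (ψ ‖x - a‖ • ‖x - a‖⁻¹ • (Ek (x - a) * ((inner ℝ (x - a) (e i) : ℝ) • (e i * f x))) -
            φ ‖x‖ • ‖x‖⁻¹ • (Ek (x - a) * ((inner ℝ x (e i) : ℝ) • (e i * f x)))) +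
            (cut φ x - cut ψ (x - a)) • (Ek (x - a) * (e i * fderiv ℝ f x (e i))) := by
          intro i
          rw [hm']
          simp [mulL_apply, add_mul', smul_mul', mul_smul', inner_sub_left]
          module
        simp only [hterm, Finset.sum_add_distrib, Finset.sum_sub_distrib, ← Finset.smul_sum,
          ← mul_sum, sum_inner_e, hL, hDx, mulz, smul_zero, zero_add, add_zero]
    · have hx := hnotU x hxU
      refine ⟨fun _ => 0, hzero x ?_, ?_⟩
      · have : ∀ᶠ y in nhds x, t < ‖y‖ := continuous_norm.continuousAt.eventually (lt_mem_nhds hx)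
        filter_upwards [this] with y hy using hGt y hy.le
      · rw [hφ ‖x‖ (Or.inr hx.le), hψ _ (Or.inr (hfar x hx.le))]
        simp
  choose V' hV' hV'' using hder
  have key := div_zero' V (fun i x => V' x i) (fun i x => hV' x i) t ht
    (fun i x hx => by simp only [hV, hGt x hx, zmul])
    (by simp only [hV'']; exact hi)
  simp only [hV''] at key
  exact key

theorem main {r : ℝ} (hr0 : 0 < r) {a : Octonion} (ha : ‖a‖ < r)
    {f : Octonion → Octonion} {U : Set Octonion} (hU : IsOpen U)
    (hsub : closedBall (0 : Octonion) r ⊆ U)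
    (hdiff : DifferentiableOn ℝ f U) (hD : ∀ x ∈ U, D f x = 0) :
    r ^ 7 • ∫ η : sphere (0 : Octonion) 1, ‖r • (η : Octonion)‖⁻¹ • (Ek (r • (η : Octonion) - a) *
      ((r • (η : Octonion)) * f (r • (η : Octonion)))) ∂sphereMeasure = ω • f a := by
  obtain ⟨δ, hδ, hδU⟩ := (isCompact_closedBall (0 : Octonion) r).exists_cthickening_subset_open
    hU hsub
  rw [cthickening_closedBall hδ.le hr0.le] at hδU
  set t := r + δ with ht
  obtain ⟨s, hs1, hs2⟩ := exists_between ha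
  have hs : 0 < s := (norm_nonneg a).trans_lt hs1
  have htr : r < t := by linarith
  have hfc : ContinuousOn f (closedBall 0 t) := hdiff.continuousOn.mono (by rwa [ht, add_comm])
  set τ := t - ‖a‖ with hτ
  have hτ0 : 0 < τ := by linarith
  set m : ℝ → Octonion := fun ρ => ∫ η : sphere (0 : Octonion) 1, f (a + ρ • (η : Octonion))
    ∂sphereMeasure with hm
  have hmc : ContinuousOn m (Icc 0 τ) := by
    refine continuousOn_sphere_integral le_rfl (fun y => f (a + y)) ?_
    refine hfc.comp (by fun_prop) ?_
    intro y hy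
    have := norm_add_le a y
    have h2 := hy.2
    simp only [mem_closedBall_zero_iff]
    linarith
  set M : ℝ → Octonion := fun ρ => ρ ^ 7 • ∫ η : sphere (0 : Octonion) 1,
    ‖ρ • (η : Octonion)‖⁻¹ • (Ek (ρ • (η : Octonion) - a) *
      ((ρ • (η : Octonion)) * f (ρ • (η : Octonion)))) ∂sphereMeasure with hM
  have hMc : ContinuousOn M (Icc s t) :=
    (by fun_prop : Continuous fun ρ : ℝ => ρ ^ 7).continuousOn.smul
      (continuousOn_sphere_integral hs.le _ (contK1 hs hs1 hfc))
  change M r = _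
  have hconst : ∀ ρ ∈ Ioo 0 τ, m ρ = M r := by
    intro ρ hρ
    have hρ2 : 0 < ρ / 2 := by have := hρ.1; linarith
    refine dirac (s := ρ / 2) (t := τ) (by linarith) hρ.2 m
      (hmc.mono (Icc_subset_Icc hρ2.le le_rfl)) _ ?_
    intro ψ hcψ hψ h1ψ
    symm
    refine dirac hs2 htr M hMc _ ?_
    intro φ hcφ hφ h1φ
    have h1 := core hU hdiff hD hcφ hcψ hs hρ2 (by linarith) hφ hψ h1φ h1ψ hs1
      (by linarith : ‖a‖ + τ ≤ t) (by rwa [ht, add_comm])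
    rw [polar_shell hcφ hs hφ _ (contK1 hs hs1 hfc),
      polar_shell hcψ hρ2 hψ _ (contK2 hρ2 (by linarith : ‖a‖ + τ ≤ t) hfc)] at h1
    rw [h1]
    congr 1
    funext u
    by_cases hu : u ≤ ρ / 2
    · rw [hψ u (Or.inl hu), zero_smul, zero_smul]
    · have hu0 : 0 < u := by linarith
      congr 1
      rw [← integral_smul]
      simp only [hm]
      congr 1
      funext η
      have hn : ‖u • (η : Octonion)‖ = u := by
        rw [norm_smul, norm_eq_of_mem_sphere η, mul_one, Real.norm_eq_abs, abs_of_pos hu0]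
      rw [Ek, smul_mul', conj_mul_mul, hn, smul_smul, smul_smul, smul_smul]
      convert one_smul ℝ _
      field_simp
  have hm0 : m 0 = M r := by
    have h1 : Filter.Tendsto m (nhdsWithin 0 (Ioo 0 τ)) (nhds (m 0)) :=
      ((hmc 0 ⟨le_rfl, hτ0.le⟩).mono Ioo_subset_Icc_self)
    have h2 : Filter.Tendsto m (nhdsWithin 0 (Ioo 0 τ)) (nhds (M r)) := by
      refine tendsto_const_nhds.congr' ?_
      filter_upwards [self_mem_nhdsWithin] with ρ hρ using (hconst ρ hρ).symm
    have : (nhdsWithin (0:ℝ) (Ioo 0 τ)).NeBot := left_nhdsWithin_Ioo_neBot hτ0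
    exact tendsto_nhds_unique h1 h2
  rw [← hm0]
  simp only [hm, zero_smul, add_zero, integral_const]
  rfl

theorem omega_ne : ω ≠ 0 := by
  have h1 : (volume : Measure Octonion).toSphere ≠ 0 := Measure.toSphere_ne_zero _
  unfold ω
  rw [ENNReal.toReal_ne_zero]
  exact ⟨fun h => h1 (Measure.measure_univ_eq_zero.1 h), measure_ne_top _ _⟩

end Octonion


/-- Cauchy reproducing formula through the scaled Szegő kernel
`Sʳ(x,a) = (r - x̄a)/|r - x̄a|⁸`: for `f` left octonionic analytic near the closed
ball of radius `r` and `|a| < r ≤ 1`, `f(a) = r⁷ (f_r, Sʳ(·,a))_{S⁷}`. -/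
theorem szego_reproducing (r : ℝ) (hr0 : 0 < r) (hr1 : r ≤ 1)
    (a : Octonion) (ha : ‖a‖ < r)
    (f : Octonion → Octonion) (U : Set Octonion) (hU : IsOpen U)
    (hsub : closedBall (0 : Octonion) r ⊆ U)
    (hdiff : DifferentiableOn ℝ f U)
    (hD : ∀ x ∈ U, Octonion.D f x = 0) :
    f a = (r ^ 7 * (Octonion.ω)⁻¹) •
      ∫ η : sphere (0 : Octonion) 1,
        ((Octonion.conj ((‖r • (1 : Octonion) - Octonion.conj (η : Octonion) * a‖ ^ 8)⁻¹ •
              (r • (1 : Octonion) - Octonion.conj (η : Octonion) * a)) *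
            Octonion.conj (η : Octonion)) *
          ((η : Octonion) * f (r • (η : Octonion))))
        ∂Octonion.sphereMeasure := by
  have hm := Octonion.main hr0 ha hU hsub hdiff hD
  rw [mul_comm, mul_smul, eq_inv_smul_iff₀ Octonion.omega_ne, ← hm]
  congr 2
  funext η
  have hη : ‖(η : Octonion)‖ = 1 := norm_eq_of_mem_sphere η
  rw [Octonion.norm_kernel r _ a hη, ← Octonion.conjL_apply (_ • _), map_smul,
    Octonion.conjL_apply, Octonion.smul_mul' (_ ^ 8)⁻¹, Octonion.kernel_eq r _ a hη,
    Octonion.smul_mul' r, Octonion.mul_smul', smul_smul, norm_smul, hη, mul_one,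
    Real.norm_eq_abs, abs_of_pos hr0, inv_mul_cancel₀ hr0.ne', one_smul]
  rfl
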